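/- arXiv:2604.26832 — 2 statements merged into one kernel-verified Lean document; each statement's English description precedes it below -/
import Mathlib

section
/- For every n ≥ 1, the substitution η̂ restricts to a bijection from the set U_n of primitive words w of length n over Γ = {0, 1, 2, 3} satisfying w(j) ∈ {0, 3} for some j, onto the set W_n of primitive two-dimensional binary words of dimension 2 × n. -/
open scoped BigOperators

noncomputable section

/-- A word `w : Fin n → Fin 4` is primitive if it is not a proper power,
i.e. there is no `d` with `0 < d < n`, `d ∣ n`, and `w j = w (j mod d)` for all `j`. -/
def Prim1D (n : ℕ) (w : Fin n → Fin 4) : Prop :=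
  ¬ ∃ (d : ℕ) (hd : 0 < d) (hdn : d < n), d ∣ n ∧
      ∀ j : Fin n, w j = w ⟨j.val % d, Nat.lt_trans (Nat.mod_lt _ hd) hdn⟩

/-- A two-dimensional binary word `W : Fin 2 → Fin n → Fin 2` is primitive if there are no
positive `p ∣ 2` and `q ∣ n` with `(p, q) ≠ (2, n)` such that
`W i j = W (i mod p) (j mod q)` for all `i, j`. -/
def Prim2D (n : ℕ) (W : Fin 2 → Fin n → Fin 2) : Prop :=
  ¬ ∃ (p q : ℕ) (hp : 0 < p) (hq : 0 < q) (hpd : p ∣ 2) (hqd : q ∣ n),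
      (p ≠ 2 ∨ q ≠ n) ∧
      ∀ (i : Fin 2) (j : Fin n),
        W i j = W ⟨i.val % p, Nat.lt_of_lt_of_le (Nat.mod_lt _ hp)
                      (Nat.le_of_dvd (by norm_num) hpd)⟩
                  ⟨j.val % q, Nat.lt_of_lt_of_le (Nat.mod_lt _ hq)
                      (Nat.le_of_dvd j.pos hqd)⟩

/-- The substitution `η` sending each symbol of `Γ = {0, 1, 2, 3}` to a column of height 2:
`0 ↦ (0,1)`, `1 ↦ (0,0)`, `2 ↦ (1,1)`, `3 ↦ (1,0)` (read top-to-bottom). -/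
def eta : Fin 4 → Fin 2 → Fin 2
  | 0 => ![0, 1]
  | 1 => ![0, 0]
  | 2 => ![1, 1]
  | 3 => ![1, 0]

/-- The extension `η̂` of `η` sending a word `w : Fin n → Fin 4` to the `2 × n`
two-dimensional binary word whose `j`-th column is `η (w j)`. -/
def etaHat {n : ℕ} (w : Fin n → Fin 4) : Fin 2 → Fin n → Fin 2 :=
  fun i j => eta (w j) i

/-- `U_n`: primitive words of length `n` over `Γ = {0,1,2,3}` containing a `0` or a `3`. -/
def Uset (n : ℕ) : Set (Fin n → Fin 4) :=
  {w | Prim1D n w ∧ ∃ j : Fin n, w j = 0 ∨ w j = 3}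

/-- `W_n`: primitive two-dimensional binary words of dimension `2 × n`. -/
def Wset (n : ℕ) : Set (Fin 2 → Fin n → Fin 2) :=
  {W | Prim2D n W}

theorem eta_injective : Function.Injective eta := by
  decide

theorem eta_surjective : Function.Surjective eta := by
  decide

theorem eta_zero_eq_eta_one_iff (a : Fin 4) : eta a 0 = eta a 1 ↔ ¬ (a = 0 ∨ a = 3) := by
  revert a
  decide

/-- `η̂(w)` is primitive exactly when `w` is primitive and contains a `0` or a `3`. -/
theorem prim2D_etaHat_iff {n : ℕ} (w : Fin n → Fin 4) :
    Prim2D n (etaHat w) ↔ Prim1D n w ∧ ∃ j : Fin n, w j = 0 ∨ w j = 3 := by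
  constructor
  · intro h
    constructor
    · rintro ⟨d, hd, hdn, hdvd, hw⟩
      refine h ⟨2, d, two_pos, hd, dvd_rfl, hdvd, Or.inr hdn.ne, fun i j => ?_⟩
      simp only [etaHat, Nat.mod_eq_of_lt i.isLt]
      rw [← hw j]
    · by_contra hne
      push Not at hne
      have hrow (j : Fin n) : eta (w j) 0 = eta (w j) 1 :=
        (eta_zero_eq_eta_one_iff _).2 (not_or.2 (hne j))
      rcases Nat.eq_zero_or_pos n with rfl | hn
      · exact h ⟨1, 1, one_pos, one_pos, one_dvd _, dvd_zero _, Or.inl (by norm_num),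
          fun _ j => j.elim0⟩
      refine h ⟨1, n, one_pos, hn, one_dvd _, dvd_rfl, Or.inl (by norm_num), fun i j => ?_⟩
      simp only [etaHat, Nat.mod_one, Nat.mod_eq_of_lt j.isLt]
      fin_cases i
      · rfl
      · exact (hrow j).symm
  · rintro ⟨hw, k, hk⟩ ⟨p, q, hp, hq, hpd, hqd, hne, hW⟩
    rcases (Nat.dvd_prime Nat.prime_two).1 hpd with rfl | rfl
    · refine (eta_zero_eq_eta_one_iff (w k)).1 ?_ hk
      have h0 := hW 0 k
      have h1 := hW 1 k
      simp only [Nat.mod_one] at h0 h1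
      exact h0.trans h1.symm
    · have hqn : q ≠ n := hne.resolve_left (fun h => h rfl)
      refine hw ⟨q, hq, lt_of_le_of_ne (Nat.le_of_dvd k.pos hqd) hqn, hqd, fun j => ?_⟩
      refine eta_injective (funext fun i => ?_)
      have hij := hW i j
      simp only [Nat.mod_eq_of_lt i.isLt] at hij
      exact hij

/-- For every `n ≥ 1`, the substitution `η̂` restricts to a bijection from `U_n` onto
`W_n`. -/
theorem stmt4 (n : ℕ) (hn : 1 ≤ n) :
    Set.BijOn (fun w : Fin n → Fin 4 => etaHat w) (Uset n) (Wset n) := by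
  refine ⟨fun w hw => (prim2D_etaHat_iff w).2 hw, fun w _ v _ h => ?_, fun W hW => ?_⟩
  · exact funext fun j => eta_injective (funext fun i => congrFun (congrFun h i) j)
  · choose w hw using fun j => eta_surjective (fun i => W i j)
    have hWw : etaHat w = W := funext fun i => funext fun j => congrFun (hw j) i
    refine ⟨w, (prim2D_etaHat_iff w).1 ?_, hWw⟩
    rwa [hWw]
end
end

section
/- Let n ≥ 1. The itinerary map ι : T_n → U_n is well defined and injective: for every p ∈ T_n the branch itinerary ι(p) belongs to U_n, and if p, p′ ∈ T_n have equal branch itineraries ι(p) = ι(p′), then p = p′. -/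
open scoped BigOperators

noncomputable section

/-- `C̄`: sorted triples `(a, b, c)` with `a ≥ b ≥ c ≥ 0` and `a + b + c = 1`. -/
def Cbar : Set (ℝ × ℝ × ℝ) :=
  {p | p.1 ≥ p.2.1 ∧ p.2.1 ≥ p.2.2 ∧ p.2.2 ≥ 0 ∧ p.1 + p.2.1 + p.2.2 = 1}

/-- `C`: non-degenerate sorted triples `(a, b, c)` with `a ≥ b ≥ c > 0` and `a + b + c = 1`. -/
def Cset : Set (ℝ × ℝ × ℝ) :=
  {p | p.1 ≥ p.2.1 ∧ p.2.1 ≥ p.2.2 ∧ p.2.2 > 0 ∧ p.1 + p.2.1 + p.2.2 = 1}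

/-- `C*`: the sorted triples in `C` with `a ≠ 1/2`. -/
def Cstar : Set (ℝ × ℝ × ℝ) :=
  {p ∈ Cset | p.1 ≠ 1/2}

/-- The four regions `R₀, R₁, R₂, R₃` partitioning `C*`. -/
def Rset : Fin 4 → Set (ℝ × ℝ × ℝ)
  | 0 => {p ∈ Cstar | p.1 < 1/2}
  | 1 => {p ∈ Cstar | p.1 > 1/2 ∧ 2*p.1 - 1 ≥ 2*p.2.1}
  | 2 => {p ∈ Cstar | p.1 > 1/2 ∧ 2*p.2.1 > 2*p.1 - 1 ∧ 2*p.1 - 1 ≥ 2*p.2.2}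
  | 3 => {p ∈ Cstar | p.1 > 1/2 ∧ 2*p.2.2 > 2*p.1 - 1}

/-- The sorted pedal map `P` (extended to a total map on `ℝ³` by the same case analysis;
on `R₀, R₁, R₂, R₃` it is given by the four branch formulas). -/
def pedal (p : ℝ × ℝ × ℝ) : ℝ × ℝ × ℝ :=
  if p.1 < 1/2 then (1 - 2*p.2.2, 1 - 2*p.2.1, 1 - 2*p.1)
  else if 2*p.1 - 1 ≥ 2*p.2.1 then (2*p.1 - 1, 2*p.2.1, 2*p.2.2)
  else if 2*p.1 - 1 ≥ 2*p.2.2 then (2*p.2.1, 2*p.1 - 1, 2*p.2.2)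
  else (2*p.2.1, 2*p.2.2, 2*p.1 - 1)

/-- The four inverse branches `I₀, I₁, I₂, I₃` of the sorted pedal map. -/
def Ibr : Fin 4 → ℝ × ℝ × ℝ → ℝ × ℝ × ℝ
  | 0, p => ((1 - p.2.2)/2, (1 - p.2.1)/2, (1 - p.1)/2)
  | 1, p => ((p.1 + 1)/2, p.2.1/2, p.2.2/2)
  | 2, p => ((p.2.1 + 1)/2, p.1/2, p.2.2/2)
  | 3, p => ((p.2.2 + 1)/2, p.1/2, p.2.1/2)

/-- The composed inverse branch `I_w = I_{w₀} ∘ I_{w₁} ∘ ⋯ ∘ I_{w_{m−1}}`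
(composition applied from right to left). -/
def Icomp : (m : ℕ) → (Fin m → Fin 4) → ℝ × ℝ × ℝ → ℝ × ℝ × ℝ
  | 0, _, p => p
  | m + 1, w, p => Ibr (w 0) (Icomp m (fun j => w j.succ) p)

/-- The Euclidean distance on `ℝ³` (represented as `ℝ × ℝ × ℝ`). -/
def eudist (p q : ℝ × ℝ × ℝ) : ℝ :=
  Real.sqrt ((p.1 - q.1)^2 + (p.2.1 - q.2.1)^2 + (p.2.2 - q.2.2)^2)

/-- `T_n`: sorted triples of exact pedal period `n`. -/
def Tset (n : ℕ) : Set (ℝ × ℝ × ℝ) :=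
  {p | p ∈ Cset ∧ (∀ j, j < n → pedal^[j] p ∈ Cstar) ∧ pedal^[n] p = p ∧
       ∀ d, 1 ≤ d → d < n → pedal^[d] p ≠ p}

/-- `w : Fin n → Fin 4` is the branch itinerary of `p`: `P^j(p) ∈ R_{w_j}` for `0 ≤ j < n`. -/
def Itinerary (n : ℕ) (p : ℝ × ℝ × ℝ) (w : Fin n → Fin 4) : Prop :=
  ∀ j : Fin n, pedal^[j.val] p ∈ Rset (w j)

/-- The squared Euclidean distance on `ℝ³`. -/
def sqDist (p q : ℝ × ℝ × ℝ) : ℝ :=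
  (p.1 - q.1)^2 + (p.2.1 - q.2.1)^2 + (p.2.2 - q.2.2)^2

theorem eq_of_sqDist_eq_zero {p q : ℝ × ℝ × ℝ} (h : sqDist p q = 0) : p = q := by
  unfold sqDist at h
  have h₁ : p.1 - q.1 = 0 := by
    nlinarith [sq_nonneg (p.1 - q.1), sq_nonneg (p.2.1 - q.2.1), sq_nonneg (p.2.2 - q.2.2)]
  have h₂ : p.2.1 - q.2.1 = 0 := by
    nlinarith [sq_nonneg (p.1 - q.1), sq_nonneg (p.2.1 - q.2.1), sq_nonneg (p.2.2 - q.2.2)]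
  have h₃ : p.2.2 - q.2.2 = 0 := by
    nlinarith [sq_nonneg (p.1 - q.1), sq_nonneg (p.2.1 - q.2.1), sq_nonneg (p.2.2 - q.2.2)]
  exact Prod.ext (by linarith) (Prod.ext (by linarith) (by linarith))

theorem pedal_of_mem_Rset_zero {p : ℝ × ℝ × ℝ} (h : p ∈ Rset 0) :
    pedal p = (1 - 2*p.2.2, 1 - 2*p.2.1, 1 - 2*p.1) :=
  if_pos h.2

theorem pedal_of_mem_Rset_one {p : ℝ × ℝ × ℝ} (h : p ∈ Rset 1) :
    pedal p = (2*p.1 - 1, 2*p.2.1, 2*p.2.2) := by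
  obtain ⟨-, h₁, h₂⟩ := h
  rw [pedal, if_neg (not_lt.2 h₁.le), if_pos h₂]

theorem pedal_of_mem_Rset_two {p : ℝ × ℝ × ℝ} (h : p ∈ Rset 2) :
    pedal p = (2*p.2.1, 2*p.1 - 1, 2*p.2.2) := by
  obtain ⟨-, h₁, h₂, h₃⟩ := h
  rw [pedal, if_neg (not_lt.2 h₁.le), if_neg (not_le.2 h₂), if_pos h₃]

theorem pedal_of_mem_Rset_three {p : ℝ × ℝ × ℝ} (h : p ∈ Rset 3) :
    pedal p = (2*p.2.1, 2*p.2.2, 2*p.1 - 1) := by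
  obtain ⟨⟨⟨-, hbc, -⟩, -⟩, h₁, h₂⟩ := h
  rw [pedal, if_neg (not_lt.2 h₁.le), if_neg (by linarith), if_neg (not_le.2 h₂)]

theorem sqDist_pedal {i : Fin 4} {p q : ℝ × ℝ × ℝ} (hp : p ∈ Rset i) (hq : q ∈ Rset i) :
    sqDist (pedal p) (pedal q) = 4 * sqDist p q := by
  match i with
  | 0 =>
    rw [pedal_of_mem_Rset_zero hp, pedal_of_mem_Rset_zero hq]
    simp only [sqDist]; ring
  | 1 =>
    rw [pedal_of_mem_Rset_one hp, pedal_of_mem_Rset_one hq]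
    simp only [sqDist]; ring
  | 2 =>
    rw [pedal_of_mem_Rset_two hp, pedal_of_mem_Rset_two hq]
    simp only [sqDist]; ring
  | 3 =>
    rw [pedal_of_mem_Rset_three hp, pedal_of_mem_Rset_three hq]
    simp only [sqDist]; ring

theorem sqDist_iterate_pedal {n : ℕ} {p q : ℝ × ℝ × ℝ}
    (h : ∀ j < n, ∃ i, pedal^[j] p ∈ Rset i ∧ pedal^[j] q ∈ Rset i) :
    sqDist (pedal^[n] p) (pedal^[n] q) = 4 ^ n * sqDist p q := by
  induction n with
  | zero => simp
  | succ n ih =>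
    obtain ⟨i, hp, hq⟩ := h n n.lt_succ_self
    rw [Function.iterate_succ_apply', Function.iterate_succ_apply', sqDist_pedal hp hq,
      ih fun j hj => h j (hj.trans n.lt_succ_self)]
    ring

/-- Two `n`-periodic points whose orbits visit the same regions coincide. -/
theorem eq_of_common_itinerary {n : ℕ} (hn : n ≠ 0) {p q : ℝ × ℝ × ℝ}
    (hp : pedal^[n] p = p) (hq : pedal^[n] q = q)
    (h : ∀ j < n, ∃ i, pedal^[j] p ∈ Rset i ∧ pedal^[j] q ∈ Rset i) : p = q := by
  have key := sqDist_iterate_pedal h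
  rw [hp, hq] at key
  have h4 : (1 : ℝ) < 4 ^ n := one_lt_pow₀ (by norm_num) hn
  refine eq_of_sqDist_eq_zero ((mul_eq_zero.1 (?_ : (4 ^ n - 1) * sqDist p q = 0)).resolve_left ?_)
  · linarith
  · linarith

theorem existsUnique_mem_Rset {p : ℝ × ℝ × ℝ} (hp : p ∈ Cstar) : ∃! i, p ∈ Rset i := by
  have hbc : p.2.1 ≥ p.2.2 := hp.1.2.1
  apply existsUnique_of_exists_of_unique
  · rcases lt_or_gt_of_ne hp.2 with h | h
    · exact ⟨0, hp, h⟩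
    · by_cases h₁ : 2*p.1 - 1 ≥ 2*p.2.1
      · exact ⟨1, hp, h, h₁⟩
      · by_cases h₂ : 2*p.1 - 1 ≥ 2*p.2.2
        · exact ⟨2, hp, h, not_le.1 h₁, h₂⟩
        · exact ⟨3, hp, h, not_le.1 h₂⟩
  · intro i j hi hj
    fin_cases i <;> fin_cases j <;> simp only [Rset, Set.mem_ofPred_eq] at hi hj ⊢ <;>
      first
      | rfl
      | (exfalso
         obtain ⟨-, hi⟩ := hi
         obtain ⟨-, hj⟩ := hj
         grind)

theorem existsUnique_itinerary {n : ℕ} {p : ℝ × ℝ × ℝ} (h : ∀ j < n, pedal^[j] p ∈ Cstar) :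
    ∃! w : Fin n → Fin 4, Itinerary n p w := by
  choose w hw huniq using fun j : Fin n => existsUnique_mem_Rset (h j j.2)
  exact ⟨w, hw, fun v hv => funext fun j => huniq j (v j) (hv j)⟩

theorem prim1D_of_itinerary {n : ℕ} {p : ℝ × ℝ × ℝ} {w : Fin n → Fin 4} (hp : p ∈ Tset n)
    (hw : Itinerary n p w) : Prim1D n w := by
  rintro ⟨d, hd, hdn, hdvd, hper⟩
  obtain ⟨-, -, hfix, hmin⟩ := hp
  have hn : 0 < n := hd.trans hdn
  have hmem : ∀ m, pedal^[m] p ∈ Rset (w ⟨m % d, (Nat.mod_lt _ hd).trans hdn⟩) := by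
    intro m
    have h := hw ⟨m % n, Nat.mod_lt _ hn⟩
    rw [hper, Function.IsPeriodicPt.iterate_mod_apply hfix] at h
    simpa only [Nat.mod_mod_of_dvd m hdvd] using h
  refine hmin d hd hdn (eq_of_common_itinerary hn.ne' ?_ hfix fun j _ => ⟨_, ?_, hmem j⟩)
  · rw [← Function.iterate_add_apply, add_comm, Function.iterate_add_apply, hfix]
  · have h := hmem (j + d)
    rw [Function.iterate_add_apply] at h
    simpa only [Nat.add_mod_right] using h

theorem iterate_pedal_snd_snd {n : ℕ} {p : ℝ × ℝ × ℝ}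
    (h : ∀ j < n, pedal^[j] p ∈ Rset 1 ∨ pedal^[j] p ∈ Rset 2) :
    (pedal^[n] p).2.2 = 2 ^ n * p.2.2 := by
  induction n with
  | zero => simp
  | succ n ih =>
    have ih := ih fun j hj => h j (hj.trans n.lt_succ_self)
    rw [Function.iterate_succ_apply', pow_succ', mul_assoc, ← ih]
    rcases h n n.lt_succ_self with h | h
    · rw [pedal_of_mem_Rset_one h]
    · rw [pedal_of_mem_Rset_two h]

theorem exists_zero_or_three_of_itinerary {n : ℕ} (hn : n ≠ 0) {p : ℝ × ℝ × ℝ}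
    {w : Fin n → Fin 4} (hp : p ∈ Tset n) (hw : Itinerary n p w) :
    ∃ j : Fin n, w j = 0 ∨ w j = 3 := by
  by_contra! hne
  have key := iterate_pedal_snd_snd (n := n) (p := p) fun j hj => by
    have hj' := hw ⟨j, hj⟩
    have h := hne ⟨j, hj⟩
    generalize w ⟨j, hj⟩ = i at hj' h
    match i with
    | 0 => exact absurd rfl h.1
    | 1 => exact Or.inl hj'
    | 2 => exact Or.inr hj'
    | 3 => exact absurd rfl h.2
  rw [hp.2.2.1] at key
  have hc : 0 < p.2.2 := hp.1.2.2.1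
  have h2 : (1 : ℝ) < 2 ^ n := one_lt_pow₀ (by norm_num) hn
  nlinarith

/-- The itinerary map `ι : T_n → U_n` is well defined and injective: every `p ∈ T_n` has a
unique branch itinerary, this itinerary lies in `U_n`, and points of `T_n` with equal
itineraries coincide. -/
theorem stmt17 (n : ℕ) (hn : 1 ≤ n) :
    (∀ p ∈ Tset n, ∃! w : Fin n → Fin 4, Itinerary n p w) ∧
    (∀ p ∈ Tset n, ∀ w : Fin n → Fin 4, Itinerary n p w → w ∈ Uset n) ∧
    (∀ p ∈ Tset n, ∀ p' ∈ Tset n, ∀ w : Fin n → Fin 4,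
        Itinerary n p w → Itinerary n p' w → p = p') := by
  have hn' : n ≠ 0 := by omega
  refine ⟨fun p hp => existsUnique_itinerary hp.2.1, fun p hp w hw => ?_,
    fun p hp p' hp' w hw hw' => ?_⟩
  · exact ⟨prim1D_of_itinerary hp hw, exists_zero_or_three_of_itinerary hn' hp hw⟩
  · exact eq_of_common_itinerary hn' hp.2.2.1 hp'.2.2.1 fun j hj =>
      ⟨w ⟨j, hj⟩, hw ⟨j, hj⟩, hw' ⟨j, hj⟩⟩
end
end
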